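/- Let D ≤ −3 be a fundamental discriminant. Then Σ_{p : (D/p) = −1} 2·(log p)/(p² − 1) = Σ_{k=1}^∞ ( (L'/L)(2^k, χ_D) − (ζ'/ζ)(2^k) − Σ_{p | D} (log p)/(p^{2^k} − 1) ), where the inner sums run over primes and the series over k converges. -/

import Mathlib

open Filter Real
open scoped Classical

/-- The Kronecker symbol `(D/p)` at a prime `p`: it is `0` if `p ∣ D`, equals the
Jacobi symbol `(D|p)` for odd `p ∤ D`, and for `p = 2 ∤ D` equals `1` if
`D ≡ 1 (mod 8)` and `-1` if `D ≡ 5 (mod 8)`. -/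
def kron (D : ℤ) (p : ℕ) : ℤ :=
  if (p : ℤ) ∣ D then 0
  else if p = 2 then (if D % 8 = 1 then 1 else -1)
  else jacobiSym D p

/-- `D` is a fundamental discriminant: either `D ≡ 1 (mod 4)` and `D` is squarefree,
or `D = 4m` with `m` squarefree and `m ≡ 2` or `3 (mod 4)`. -/
def IsFundamentalDiscriminant (D : ℤ) : Prop :=
  (D % 4 = 1 ∧ Squarefree D) ∨
  (∃ m : ℤ, D = 4 * m ∧ Squarefree m ∧ (m % 4 = 2 ∨ m % 4 = 3))

/-- `S_D`: the multiplicative semigroup generated by the primes `p` with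
`(D/p) = 1` together with the squares of the primes `q` with `(D/q) = -1`;
equivalently, the positive integers `n` such that every prime `p ∣ n` has
`(D/p) = 1`, or `(D/p) = -1` and `p` occurs in `n` to an even exponent. -/
def SD (D : ℤ) : Set ℕ :=
  {n : ℕ | 0 < n ∧ ∀ p : ℕ, p.Prime → p ∣ n →
    (kron D p = 1 ∨ (kron D p = -1 ∧ Even (n.factorization p)))}

/-- `χ` is the completely multiplicative function `χ_D` with `χ_D(p) = (D/p)` on
primes. -/
def IsChiD (D : ℤ) (χ : ℕ → ℤ) : Prop :=
  χ 0 = 0 ∧ χ 1 = 1 ∧ (∀ m n : ℕ, χ (m * n) = χ m * χ n) ∧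
    ∀ p : ℕ, p.Prime → χ p = kron D p

/-- `L(s,χ) = ∑_{n ≥ 1} χ(n) n^{-s}` (for real `s > 1`). -/
noncomputable def LChi (χ : ℕ → ℤ) (s : ℝ) : ℝ :=
  ∑' n : ℕ, (χ n : ℝ) * (n : ℝ) ^ (-s)

/-- `L'(s,χ) = -∑_{n ≥ 1} χ(n) (log n) n^{-s}` (for real `s > 1`). -/
noncomputable def LChi' (χ : ℕ → ℤ) (s : ℝ) : ℝ :=
  -∑' n : ℕ, (χ n : ℝ) * Real.log n * (n : ℝ) ^ (-s)

/-- The Riemann zeta function `ζ(s) = ∑_{n ≥ 1} n^{-s}` (for real `s > 1`). -/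
noncomputable def zetaR (s : ℝ) : ℝ := ∑' n : ℕ, (n : ℝ) ^ (-s)

/-- `ζ'(s) = -∑_{n ≥ 1} (log n) n^{-s}` (for real `s > 1`). -/
noncomputable def zetaR' (s : ℝ) : ℝ := -∑' n : ℕ, Real.log n * (n : ℝ) ^ (-s)

/-- The logarithmic derivative of a completely multiplicative series as a sum over primes. -/
theorem hasSum_primes_log_mul_div {f : ℕ →*₀ ℝ} (hf : Summable fun n => |f n|)
    (hlog : Summable fun n : ℕ => |f n| * Real.log n) :
    HasSum (fun p : Nat.Primes => Real.log p * (f p / (1 - f p)))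
      ((∑' n : ℕ, f n * Real.log n) / ∑' n : ℕ, f n) := by
  have hne : (∑' n : ℕ, f n) ≠ 0 := by
    let F : ℕ →*₀ ℂ := (Complex.ofRealHom.toMonoidWithZeroHom).comp f
    have hF (n : ℕ) : F n = (f n : ℂ) := rfl
    have h := EulerProduct.exp_tsum_primes_log_eq_tsum (f := F) (by simpa [hF] using hf)
    simp only [hF, ← Complex.ofReal_tsum] at h
    intro h0
    simp [h0] at h
  have hΛ : Summable fun n : ℕ => f n * ArithmeticFunction.vonMangoldt n := by
    refine .of_norm_bounded hlog fun n => ?_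
    rw [norm_mul, Real.norm_eq_abs, Real.norm_eq_abs,
      abs_of_nonneg ArithmeticFunction.vonMangoldt_nonneg]
    exact mul_le_mul_of_nonneg_left ArithmeticFunction.vonMangoldt_le_log (abs_nonneg _)
  have hprod : (∑' n : ℕ, f n * ArithmeticFunction.vonMangoldt n) * ∑' n : ℕ, f n =
      ∑' n : ℕ, f n * Real.log n := by
    have hpair := HasSum.mul hΛ.hasSum hf.of_abs.hasSum
      (summable_mul_of_summable_norm (f := fun n : ℕ => f n * ArithmeticFunction.vonMangoldt n)
        (g := fun n : ℕ => f n) hΛ.norm hf.of_abs.norm)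
    rw [← (hpair.tsum_fiberwise fun x : ℕ × ℕ => x.1 * x.2).tsum_eq]
    refine tsum_congr fun n => ?_
    have hfib : ∀ x : (fun x : ℕ × ℕ => x.1 * x.2) ⁻¹' {n},
        f x.1.1 * ArithmeticFunction.vonMangoldt x.1.1 * f x.1.2 =
          f n * ArithmeticFunction.vonMangoldt x.1.1 := by
      rintro ⟨x, hx⟩
      have hx' : x.1 * x.2 = n := hx
      have hfx : f n = f x.1 * f x.2 := by rw [← map_mul, hx']
      rw [hfx]
      ring
    rw [tsum_congr hfib, tsum_mul_left]
    rcases eq_or_ne n 0 with rfl | hn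
    · simp
    · have hset : ((fun x : ℕ × ℕ => x.1 * x.2) ⁻¹' {n}) = ↑n.divisorsAntidiagonal := by
        ext x
        simp [hn]
      rw [hset, Finset.tsum_subtype' n.divisorsAntidiagonal
        (fun x : ℕ × ℕ => ArithmeticFunction.vonMangoldt x.1),
        Nat.sum_divisorsAntidiagonal (fun d _ => ArithmeticFunction.vonMangoldt d),
        ArithmeticFunction.vonMangoldt_sum]
  rw [← hprod, mul_div_cancel_right₀ _ hne]
  have hsupp : Function.support (fun n : ℕ => f n * ArithmeticFunction.vonMangoldt n) ⊆
      {n | IsPrimePow n} := by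
    intro n hn
    exact ArithmeticFunction.vonMangoldt_ne_zero_iff.mp (right_ne_zero_of_mul hn)
  have h := (Equiv.hasSum_iff Nat.Primes.prodNatEquiv).mpr
    ((hasSum_subtype_iff_of_support_subset hsupp).mpr hΛ.hasSum)
  refine h.prod_fiberwise fun p => ?_
  have hp : |f p| < 1 := by
    simpa using hf.of_abs.norm_lt_one (f := f.toMonoidHom) p.2.one_lt
  have hgeo := ((hasSum_geometric_of_abs_lt_one hp).mul_left (Real.log p * f p))
  convert! hgeo using 1
  · ext k
    simp only [Function.comp_apply, Nat.Primes.prodNatEquiv_apply, map_pow]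
    rw [ArithmeticFunction.vonMangoldt_apply_pow k.succ_ne_zero,
      ArithmeticFunction.vonMangoldt_apply_prime p.2]
    ring
  · ring

theorem summable_log_mul_rpow_neg {s : ℝ} (hs : 1 < s) :
    Summable fun n : ℕ => Real.log n * (n : ℝ) ^ (-s) := by
  have hε : 0 < (s - 1) / 2 := by linarith
  refine .of_nonneg_of_le (fun n => by positivity) (fun n => ?_)
    ((Real.summable_nat_rpow.mpr (show -((s + 1) / 2) < -1 by linarith)).mul_left
      ((s - 1) / 2)⁻¹)
  rcases Nat.eq_zero_or_pos n with rfl | hn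
  · simp only [Nat.cast_zero, Real.log_zero, zero_mul]
    positivity
  have hn' : (0 : ℝ) < n := by exact_mod_cast hn
  calc Real.log n * (n : ℝ) ^ (-s)
      ≤ (n : ℝ) ^ ((s - 1) / 2) / ((s - 1) / 2) * (n : ℝ) ^ (-s) := by
        gcongr
        exact Real.log_le_rpow_div hn'.le hε
    _ = ((s - 1) / 2)⁻¹ * ((n : ℝ) ^ ((s - 1) / 2) * (n : ℝ) ^ (-s)) := by ring
    _ = _ := by
        rw [← Real.rpow_add hn']
        ring_nf

theorem hasSum_primes_neg_logDeriv_LChi {χ : ℕ → ℤ} (h0 : χ 0 = 0) (h1 : χ 1 = 1)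
    (hmul : ∀ m n : ℕ, χ (m * n) = χ m * χ n) (hle : ∀ n, |χ n| ≤ 1) {s : ℝ} (hs : 1 < s) :
    HasSum (fun p : Nat.Primes => Real.log p * ((χ p : ℝ) / ((p : ℝ) ^ s - χ p)))
      (-(LChi' χ s / LChi χ s)) := by
  let f : ℕ →*₀ ℝ :=
    { toFun := fun n => (χ n : ℝ) * (n : ℝ) ^ (-s)
      map_zero' := by simp [h0]
      map_one' := by simp [h1]
      map_mul' := fun m n => by
        rw [hmul, Nat.cast_mul, Real.mul_rpow m.cast_nonneg n.cast_nonneg]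
        push_cast
        ring }
  have hf (n : ℕ) : f n = (χ n : ℝ) * (n : ℝ) ^ (-s) := rfl
  have hfle (n : ℕ) : |f n| ≤ (n : ℝ) ^ (-s) := by
    have hpos : (0 : ℝ) ≤ (n : ℝ) ^ (-s) := by positivity
    rw [hf, abs_mul, abs_of_nonneg hpos]
    exact mul_le_of_le_one_left hpos (by exact_mod_cast hle n)
  have key := hasSum_primes_log_mul_div (f := f)
    (.of_nonneg_of_le (fun _ => abs_nonneg _) hfle
      (Real.summable_nat_rpow.mpr (by linarith)))
    (.of_nonneg_of_le (fun _ => by positivity)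
      (fun n => by
        rw [mul_comm]
        exact mul_le_mul_of_nonneg_left (hfle n) (Real.log_natCast_nonneg n))
      (summable_log_mul_rpow_neg hs))
  convert! key using 1
  · ext p
    have hp : (0 : ℝ) < (p : ℝ) ^ s := Real.rpow_pos_of_pos (by exact_mod_cast p.2.pos) s
    rw [hf, Real.rpow_neg (Nat.cast_nonneg _), ← mul_div_mul_right _ (1 - _) hp.ne', sub_mul,
      mul_assoc, inv_mul_cancel₀ hp.ne', mul_one, one_mul]
  · simp only [LChi', LChi, hf, neg_div, neg_neg]
    congr 1
    exact tsum_congr fun n => by ring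

theorem hasSum_primes_neg_logDeriv_zetaR {s : ℝ} (hs : 1 < s) :
    HasSum (fun p : Nat.Primes => Real.log p / ((p : ℝ) ^ s - 1))
      (-(zetaR' s / zetaR s)) := by
  have h := hasSum_primes_neg_logDeriv_LChi (χ := fun n => if n = 0 then 0 else 1) (by simp)
    (by simp) (fun m n => by by_cases hm : m = 0 <;> by_cases hn : n = 0 <;> simp [hm, hn])
    (fun n => by by_cases hn : n = 0 <;> simp [hn]) hs
  have hz : -s ≠ 0 := by linarith
  convert! h using 1
  · ext p
    simp [p.2.ne_zero, div_eq_mul_inv]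
  · simp only [zetaR, zetaR', LChi, LChi']
    congr 4 <;> ext n <;> by_cases hn : n = 0 <;> simp [hn, Real.zero_rpow hz]

theorem kron_eq_zero_or_one_or_neg_one {D : ℤ} {p : ℕ} :
    kron D p = 0 ∨ kron D p = 1 ∨ kron D p = -1 := by
  unfold kron
  split_ifs
  · simp
  · simp
  · simp
  · exact jacobiSym.trichotomy D p

theorem kron_eq_zero_iff {D : ℤ} {p : ℕ} (hp : p.Prime) : kron D p = 0 ↔ (p : ℤ) ∣ D := by
  refine ⟨fun h => ?_, fun h => by simp [kron, h]⟩
  by_contra hD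
  rw [kron, if_neg hD] at h
  split_ifs at h
  · norm_num at h
  refine jacobiSym.ne_zero ?_ h
  rw [Int.gcd_comm]
  exact Int.isCoprime_iff_gcd_eq_one.mp
    ((Nat.prime_iff_prime_int.mp hp).coprime_iff_not_dvd.mpr hD)

theorem IsChiD.abs_le_one {D : ℤ} {χ : ℕ → ℤ} (hχ : IsChiD D χ) (n : ℕ) : |χ n| ≤ 1 := by
  obtain ⟨h0, h1, hmul, hprime⟩ := hχ
  induction n using induction_on_primes with
  | zero => simp [h0]
  | one => simp [h1]
  | prime_mul p a hp ih =>
    rw [hmul, abs_mul, hprime p hp]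
    refine mul_le_one₀ ?_ (abs_nonneg _) ih
    rcases kron_eq_zero_or_one_or_neg_one (D := D) (p := p) with h | h | h <;> simp [h]

theorem hasSum_pow_two_pow_div {x : ℝ} (hx : 1 < x) :
    HasSum (fun k : ℕ => x ^ 2 ^ (k + 1) / ((x ^ 2 ^ (k + 1)) ^ 2 - 1)) (1 / (x ^ 2 - 1)) := by
  have hgt (k : ℕ) : 1 < x ^ 2 ^ (k + 1) := one_lt_pow₀ hx (by positivity)
  have hterm (k : ℕ) : x ^ 2 ^ (k + 1) / ((x ^ 2 ^ (k + 1)) ^ 2 - 1) =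
      1 / (x ^ 2 ^ (k + 1) - 1) - 1 / (x ^ 2 ^ (k + 1 + 1) - 1) := by
    rw [pow_succ 2 (k + 1), pow_mul]
    have := hgt k
    generalize x ^ 2 ^ (k + 1) = y at this
    have h1 : y - 1 ≠ 0 := by linarith
    have h2 : y ^ 2 - 1 ≠ 0 := by nlinarith
    field_simp
    ring
  rw [hasSum_iff_tendsto_nat_of_nonneg fun k => ?_]
  · simp only [hterm]
    simp only [Finset.sum_range_sub' (fun k => 1 / (x ^ 2 ^ (k + 1) - 1))]
    have hlim : Tendsto (fun k : ℕ => x ^ 2 ^ (k + 1) - 1) atTop atTop :=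
      tendsto_atTop_add_const_right _ (-1) ((tendsto_pow_atTop_atTop_of_one_lt hx).comp
        ((tendsto_pow_atTop_atTop_of_one_lt (one_lt_two : (1 : ℕ) < 2)).comp (tendsto_add_atTop_nat 1)))
    simpa [Function.comp_def] using hlim.inv_tendsto_atTop.const_sub (x ^ 2 - 1)⁻¹
  · have := hgt k
    exact div_nonneg (by linarith) (by nlinarith)

/-- The level-`k` contribution is a sum over the primes `p` with `(D/p) = -1`. -/
theorem hasSum_primes_kron_neg_one {D : ℤ} (hD : D ≠ 0) {χ : ℕ → ℤ} (hχ : IsChiD D χ) {m : ℕ}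
    (hm : 1 < m) :
    HasSum (fun p : Nat.Primes => if kron D p = -1 then
        2 * Real.log p * ((p : ℝ) ^ m / (((p : ℝ) ^ m) ^ 2 - 1)) else 0)
      (LChi' χ m / LChi χ m - zetaR' m / zetaR m -
        ∑ p ∈ D.natAbs.primeFactors, Real.log p / ((p : ℝ) ^ m - 1)) := by
  have hm' : (1 : ℝ) < m := by exact_mod_cast hm
  have hL := hasSum_primes_neg_logDeriv_LChi hχ.1 hχ.2.1 hχ.2.2.1 hχ.abs_le_one hm'
  have hZ := hasSum_primes_neg_logDeriv_zetaR hm'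
  have hR : HasSum (fun p : Nat.Primes => if p.1 ∈ D.natAbs.primeFactors then
      Real.log p / ((p : ℝ) ^ m - 1) else 0)
      (∑ p ∈ D.natAbs.primeFactors, Real.log p / ((p : ℝ) ^ m - 1)) := by
    set r : ℕ → ℝ := fun p => if p ∈ D.natAbs.primeFactors then
      Real.log p / ((p : ℝ) ^ m - 1) else 0 with hr
    have hfin : HasSum r (∑ p ∈ D.natAbs.primeFactors, r p) :=
      hasSum_sum_of_ne_finset_zero fun p hp => if_neg hp
    have hsupp : Function.support r ⊆ {p : ℕ | p.Prime} := by
      intro p hp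
      by_contra hp'
      exact hp (if_neg fun h => hp' (Nat.prime_of_mem_primeFactors h))
    have hsum : ∑ p ∈ D.natAbs.primeFactors, Real.log p / ((p : ℝ) ^ m - 1) =
        ∑ p ∈ D.natAbs.primeFactors, r p :=
      Finset.sum_congr rfl fun p hp => (if_pos hp).symm
    rw [hsum]
    exact (hasSum_subtype_iff_of_support_subset hsupp).mpr hfin
  convert! (hZ.sub hL).sub hR using 1
  · ext p
    have hp : (p : ℕ).Prime := p.2
    have hgt : 1 < (p : ℝ) ^ m := one_lt_pow₀ (by exact_mod_cast hp.one_lt) (by omega)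
    have hmem : p.1 ∈ D.natAbs.primeFactors ↔ kron D p = 0 := by
      rw [kron_eq_zero_iff hp, Nat.mem_primeFactors, Int.natCast_dvd]
      simp [hp, hD]
    simp only [hmem, hχ.2.2.2 p hp, Real.rpow_natCast]
    generalize (p : ℝ) ^ m = y at hgt
    rcases kron_eq_zero_or_one_or_neg_one (D := D) (p := p) with h | h | h
    · simp [h]
    · simp [h, div_eq_mul_inv]
    · have h1 : y - 1 ≠ 0 := by linarith
      have h2 : y + 1 ≠ 0 := by linarith
      have h3 : y ^ 2 - 1 ≠ 0 := by nlinarith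
      simp only [h, Int.cast_neg, Int.cast_one, sub_neg_eq_add, if_true]
      norm_num
      field_simp
      ring
  · ring

/-- For a fundamental discriminant `D ≤ -3`:
`∑_{(D/p) = -1} 2 log p/(p² - 1)
  = ∑_{k ≥ 1} ((L'/L)(2ᵏ,χ_D) - (ζ'/ζ)(2ᵏ) - ∑_{p ∣ D} log p/(p^{2ᵏ} - 1))`,
and the series over `k` converges. -/
theorem sum_kron_neg_one_eq (D : ℤ) (hD : D ≤ -3)
    (hfund : IsFundamentalDiscriminant D) (χD : ℕ → ℤ) (hχ : IsChiD D χD) :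
    Summable (fun k : ℕ =>
      LChi' χD ((2 : ℝ) ^ (k + 1)) / LChi χD ((2 : ℝ) ^ (k + 1)) -
        zetaR' ((2 : ℝ) ^ (k + 1)) / zetaR ((2 : ℝ) ^ (k + 1)) -
        ∑ p ∈ D.natAbs.primeFactors, Real.log p / ((p : ℝ) ^ 2 ^ (k + 1) - 1)) ∧
    (∑' p : {p : ℕ // p.Prime ∧ kron D p = -1}, 2 * Real.log p / ((p : ℝ) ^ 2 - 1)) =
      ∑' k : ℕ,
        (LChi' χD ((2 : ℝ) ^ (k + 1)) / LChi χD ((2 : ℝ) ^ (k + 1)) -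
          zetaR' ((2 : ℝ) ^ (k + 1)) / zetaR ((2 : ℝ) ^ (k + 1)) -
          ∑ p ∈ D.natAbs.primeFactors, Real.log p / ((p : ℝ) ^ 2 ^ (k + 1) - 1)) := by
  have hterm (k : ℕ) := hasSum_primes_kron_neg_one (by omega : D ≠ 0) hχ
    (Nat.one_lt_two_pow k.succ_ne_zero)
  simp only [Nat.succ_eq_add_one, Nat.cast_pow, Nat.cast_ofNat] at hterm
  set T : Nat.Primes × ℕ → ℝ := fun x => if kron D x.1 = -1 then
    2 * Real.log x.1 * ((x.1 : ℝ) ^ 2 ^ (x.2 + 1) / (((x.1 : ℝ) ^ 2 ^ (x.2 + 1)) ^ 2 - 1))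
    else 0 with hT
  set g : Nat.Primes → ℝ := fun p => if kron D p = -1 then
    2 * Real.log p / ((p : ℝ) ^ 2 - 1) else 0 with hg
  have hgt (p : Nat.Primes) : (1 : ℝ) < p := by exact_mod_cast p.2.one_lt
  have hcol (p : Nat.Primes) : HasSum (fun k => T (p, k)) (g p) := by
    by_cases hp : kron D p = -1
    · simpa [hT, hg, hp, div_eq_mul_inv] using
        (hasSum_pow_two_pow_div (hgt p)).mul_left (2 * Real.log p)
    · simp [hT, hg, hp, hasSum_zero]
  have hnonneg : 0 ≤ T := by
    intro x
    have hx : 1 < (x.1 : ℝ) ^ 2 ^ (x.2 + 1) := one_lt_pow₀ (hgt x.1) (by positivity)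
    simp only [hT, Pi.zero_apply]
    split_ifs
    · have hlog := Real.log_natCast_nonneg x.1
      exact mul_nonneg (by positivity) (div_nonneg (by linarith) (by nlinarith))
    · exact le_rfl
  have hgsum : Summable g := by
    refine .of_nonneg_of_le (fun p => (hcol p).nonneg fun k => hnonneg _) (fun p => ?_)
      ((hasSum_primes_neg_logDeriv_zetaR one_lt_two).summable.mul_left 2)
    have hp : 0 < (p : ℝ) ^ 2 - 1 := by nlinarith [hgt p]
    have hlog := Real.log_natCast_nonneg p
    simp only [hg, Real.rpow_two, ← mul_div_assoc]
    split_ifs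
    · exact le_rfl
    · positivity
  have hTsum : Summable T := (summable_prod_of_nonneg hnonneg).mpr
    ⟨fun p => (hcol p).summable, by simpa only [(hcol _).tsum_eq] using hgsum⟩
  have htotal : HasSum T (∑' p, g p) := by
    rw [(hTsum.hasSum.prod_fiberwise hcol).tsum_eq]
    exact hTsum.hasSum
  have hrow := ((Equiv.prodComm ℕ Nat.Primes).hasSum_iff.mpr htotal).prod_fiberwise hterm
  refine ⟨hrow.summable, ?_⟩
  rw [hrow.tsum_eq]
  have hleft := tsum_subtype {p : ℕ | p.Prime ∧ kron D p = -1}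
    fun p : ℕ => 2 * Real.log p / ((p : ℝ) ^ 2 - 1)
  have hright := tsum_subtype {p : ℕ | p.Prime}
    fun p : ℕ => if kron D p = -1 then 2 * Real.log p / ((p : ℝ) ^ 2 - 1) else 0
  refine hleft.trans (Eq.trans (tsum_congr fun p => ?_) hright.symm)
  by_cases hp : p.Prime <;> by_cases hk : kron D p = -1 <;> simp [Set.indicator, hp, hk]
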